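/- arXiv:1706.09593 — 7 statements merged into one kernel-verified Lean document; each statement's English description precedes it below -/
import Mathlib

section
/- If (s, c) is a mutual closest pair of a symmetric preference system d with quota function q, then every stable matching M satisfies M(s) = c. -/
/-- If (s, c) is a mutual closest pair, every stable matching M
satisfies M(s) = c. -/
theorem stmt2 {S C : Type*} [Fintype S] [Fintype C] [Nonempty S] [Nonempty C]
    [DecidableEq S] [DecidableEq C]
    (d : S → C → ℝ) (hd : Function.Injective fun p : S × C => d p.1 p.2)
    (q : C → ℕ) (hq : ∑ c, q c = Fintype.card S)
    (s : S) (c : C) (hc : 0 < q c)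
    (hmcp : (∀ c' : C, c' ≠ c → 0 < q c' → d s c < d s c') ∧
            (∀ s' : S, s' ≠ s → d s c < d s' c))
    (M : S → C)
    (hM : ∀ c' : C, (Finset.univ.filter fun s' => M s' = c').card = q c')
    (hstable : ¬ ∃ (s' : S) (c' : C), M s' ≠ c' ∧ d s' c' < d s' (M s') ∧
        ∃ s'' : S, M s'' = c' ∧ d s' c' < d s'' c') :
    M s = c := by
  by_contra h
  apply hstable
  have h1 : 0 < q (M s) := by
    rw [← hM (M s)]
    exact Finset.card_pos.mpr ⟨s, by simp⟩
  have h2 := hc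
  rw [← hM c] at h2
  obtain ⟨t, ht⟩ := Finset.card_pos.mp h2
  have ht' : M t = c := by simpa using ht
  refine ⟨s, c, h, hmcp.1 _ h h1, t, ht', hmcp.2 t ?_⟩
  rintro rfl
  exact h ht'
end

section
/- Let (s, c) be a mutual closest pair and let M be a stable matching with M(s) = c. Then the restriction of M to the students S \ {s} is a stable matching for the reduced problem in which the quota of c is decreased by one and all other quotas are unchanged (with the same distance function d restricted to S \ {s}). -/
/-- If (s, c) is a mutual closest pair and M is a stable matching with
M(s) = c, then the restriction of M to S \ {s} is a stable matching of the reduced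
problem where the quota of c is decreased by one. -/
theorem stmt3 {S C : Type*} [Fintype S] [Fintype C] [Nonempty S] [Nonempty C]
    [DecidableEq S] [DecidableEq C]
    (d : S → C → ℝ) (hd : Function.Injective fun p : S × C => d p.1 p.2)
    (q : C → ℕ) (hq : ∑ c, q c = Fintype.card S)
    (s : S) (c : C) (hc : 0 < q c)
    (hmcp : (∀ c' : C, c' ≠ c → 0 < q c' → d s c < d s c') ∧
            (∀ s' : S, s' ≠ s → d s c < d s' c))
    (M : S → C)
    (hM : ∀ c' : C, (Finset.univ.filter fun s' => M s' = c').card = q c')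
    (hstable : ¬ ∃ (s' : S) (c' : C), M s' ≠ c' ∧ d s' c' < d s' (M s') ∧
        ∃ s'' : S, M s'' = c' ∧ d s' c' < d s'' c')
    (hMs : M s = c) :
    (∀ c' : C, (Finset.univ.filter fun x : {x : S // x ≠ s} => M x.1 = c').card
        = (if c' = c then q c - 1 else q c')) ∧
    ¬ ∃ (x : {x : S // x ≠ s}) (c' : C), M x.1 ≠ c' ∧ d x.1 c' < d x.1 (M x.1) ∧
        ∃ y : {y : S // y ≠ s}, M y.1 = c' ∧ d x.1 c' < d y.1 c' := by
  constructor
  · intro c'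
    have h1 : (Finset.univ.filter fun x : {x : S // x ≠ s} => M x.1 = c').card
        = ((Finset.univ.filter fun s' => M s' = c').erase s).card := by
      rw [← Finset.card_map (Function.Embedding.subtype _)]
      congr 1
      ext a
      simp [and_comm]
    rw [h1]
    split_ifs with h
    · subst h
      rw [Finset.card_erase_of_mem (by simp [hMs]), hM]
    · rw [Finset.erase_eq_of_notMem, hM]
      simp only [Finset.mem_filter, Finset.mem_univ, true_and, hMs]
      exact fun e => h e.symm
  · rintro ⟨x, c', h1, h2, y, h3, h4⟩
    exact hstable ⟨x.1, c', h1, h2, y.1, h3, h4⟩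
end

section
/- Let (s, c) be a mutual closest pair, and let M' be a stable matching of the reduced problem on students S \ {s} with quota function q' equal to q except q'(c) = q(c) − 1 (with the same distance function d restricted to S \ {s}). Then the extension M of M' defined by M(s) = c is a stable matching of the original problem with quota function q. -/
/-- If (s, c) is a mutual closest pair and M' is a stable matching of the
reduced problem on S \ {s} (with the quota of c decreased by one), then the extension M
of M' with M(s) = c is a stable matching of the original problem. -/
theorem stmt4 {S C : Type*} [Fintype S] [Fintype C] [Nonempty S] [Nonempty C]
    [DecidableEq S] [DecidableEq C]
    (d : S → C → ℝ) (hd : Function.Injective fun p : S × C => d p.1 p.2)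
    (q : C → ℕ) (hq : ∑ c, q c = Fintype.card S)
    (s : S) (c : C) (hc : 0 < q c)
    (hmcp : (∀ c' : C, c' ≠ c → 0 < q c' → d s c < d s c') ∧
            (∀ s' : S, s' ≠ s → d s c < d s' c))
    (M' : {x : S // x ≠ s} → C)
    (hM' : ∀ c' : C, (Finset.univ.filter fun x : {x : S // x ≠ s} => M' x = c').card
        = (if c' = c then q c - 1 else q c'))
    (hstable' : ¬ ∃ (x : {x : S // x ≠ s}) (c' : C), M' x ≠ c' ∧
        d x.1 c' < d x.1 (M' x) ∧
        ∃ y : {y : S // y ≠ s}, M' y = c' ∧ d x.1 c' < d y.1 c')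
    (M : S → C)
    (hMdef : ∀ x : S, M x = if h : x = s then c else M' ⟨x, h⟩) :
    (∀ c' : C, (Finset.univ.filter fun s' => M s' = c').card = q c') ∧
    ¬ ∃ (s' : S) (c' : C), M s' ≠ c' ∧ d s' c' < d s' (M s') ∧
        ∃ s'' : S, M s'' = c' ∧ d s' c' < d s'' c' := by
  have hs : M s = c := by simp [hMdef]
  have hne : ∀ x : {x : S // x ≠ s}, M x.1 = M' x := by
    intro x
    rw [hMdef, dif_neg x.2]
  have hcount : ∀ c' : C, (Finset.univ.filter fun s' => M s' = c').card = q c' := by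
    intro c'
    have h := hM' c'
    rw [Finset.card_filter] at h ⊢
    rw [Fintype.sum_eq_add_sum_subtype_ne _ s]
    simp only [hne, hs]
    rw [h]
    by_cases hcc : c' = c
    · subst hcc
      simp
      omega
    · simp [hcc, Ne.symm hcc]
  refine ⟨hcount, ?_⟩
  rintro ⟨x, c', h1, h2, y, hy, h3⟩
  by_cases hx : x = s
  · subst hx
    rw [hs] at h1 h2
    have hpos : 0 < q c' := by
      rw [← hcount c']
      exact Finset.card_pos.mpr ⟨y, by simp [hy]⟩
    exact lt_asymm h2 (hmcp.1 c' (Ne.symm h1) hpos)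
  · by_cases hys : y = s
    · subst hys
      rw [hs] at hy
      subst hy
      exact lt_asymm h3 (hmcp.2 x hx)
    · have ex := hne ⟨x, hx⟩
      have ey := hne ⟨y, hys⟩
      simp only at ex ey
      rw [ex] at h1 h2
      rw [ey] at hy
      exact hstable' ⟨⟨x, hx⟩, c', h1, h2, ⟨y, hys⟩, hy, h3⟩
end

section
/- For every symmetric preference system d : S → C → ℝ and every quota function q : C → ℕ with ∑_{c ∈ C} q(c) = |S|, there exists a stable matching. -/
theorem stmt5_aux {S C : Type*} [Fintype C] [Nonempty C] [DecidableEq C] [DecidableEq S]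
    (d : S → C → ℝ) (n : ℕ) : ∀ (T : Finset S) (q : C → ℕ), T.card = n → ∑ c, q c = n →
    ∃ M : S → C, (∀ c : C, (T.filter fun s => M s = c).card = q c) ∧
      ∀ s ∈ T, ∀ s' ∈ T, d s (M s') < d s (M s) → ¬ d s (M s') < d s' (M s') := by
  induction n with
  | zero =>
    intro T q hT hq
    have hT' : T = ∅ := Finset.card_eq_zero.mp hT
    subst hT'
    refine ⟨fun _ => Classical.arbitrary C, fun c => ?_, by simp⟩
    have := (Finset.sum_eq_zero_iff.mp hq) c (Finset.mem_univ c)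
    simp [this]
  | succ n ih =>
    intro T q hT hq
    have hTn : T.Nonempty := Finset.card_pos.mp (by omega)
    have hCn : (Finset.univ.filter fun c => 0 < q c).Nonempty := by
      by_contra h
      rw [Finset.not_nonempty_iff_eq_empty, Finset.filter_eq_empty_iff] at h
      have : ∑ c, q c = 0 := Finset.sum_eq_zero fun c hc => by
        have := h hc
        omega
      omega
    obtain ⟨⟨s0, c0⟩, hmem, hmin⟩ := Finset.exists_min_image
      (T ×ˢ (Finset.univ.filter fun c => 0 < q c)) (fun p => d p.1 p.2) (hTn.product hCn)
    simp only [Finset.mem_product, Finset.mem_filter, Finset.mem_univ, true_and] at hmem hmin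
    obtain ⟨hs0, hc0⟩ := hmem
    have hmin' : ∀ s ∈ T, ∀ c, 0 < q c → d s0 c0 ≤ d s c := fun s hs c hc =>
      hmin (s, c) ⟨hs, hc⟩
    have hsum : ∑ c, Function.update q c0 (q c0 - 1) c = n := by
      rw [Finset.sum_update_of_mem (Finset.mem_univ c0)]
      have := Finset.sum_eq_add_sum_sdiff_singleton_of_mem (Finset.mem_univ c0) q
      omega
    obtain ⟨M, hM, hst⟩ := ih (T.erase s0) (Function.update q c0 (q c0 - 1))
      (by rw [Finset.card_erase_of_mem hs0]; omega) hsum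
    have hcard : ∀ c, (T.filter fun s => Function.update M s0 c0 s = c).card = q c := by
      intro c
      have hc := hM c
      rw [← Finset.insert_erase hs0, Finset.filter_insert]
      have he : ((T.erase s0).filter fun s => Function.update M s0 c0 s = c)
          = (T.erase s0).filter fun s => M s = c := by
        apply Finset.filter_congr
        intro s hs
        rw [Function.update_of_ne (Finset.ne_of_mem_erase hs)]
      rw [he, Function.update_self]
      by_cases h : c0 = c
      · subst h
        rw [if_pos rfl, Finset.card_insert_of_notMem (by simp), hc, Function.update_self]
        omega
      · rw [if_neg h, hc, Function.update_of_ne (Ne.symm h)]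
    refine ⟨Function.update M s0 c0, hcard, ?_⟩
    intro s hs s' hs' h1 h2
    have hpos : 0 < q (Function.update M s0 c0 s') := by
      rw [← hcard]
      exact Finset.card_pos.mpr ⟨s', by simp [hs']⟩
    have hle := hmin' s hs _ hpos
    by_cases e : s = s0
    · subst e
      rw [Function.update_self] at h1
      linarith
    by_cases e' : s' = s0
    · subst e'
      rw [Function.update_self] at h2 hle
      linarith
    rw [Function.update_of_ne e', Function.update_of_ne e] at h1
    rw [Function.update_of_ne e'] at h2
    exact hst s (Finset.mem_erase.mpr ⟨e, hs⟩) s' (Finset.mem_erase.mpr ⟨e', hs'⟩) h1 h2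

/-- For every symmetric preference system and quota function,
there exists a stable matching. -/
theorem stmt5 {S C : Type*} [Fintype S] [Fintype C] [Nonempty S] [Nonempty C]
    [DecidableEq C]
    (d : S → C → ℝ) (hd : Function.Injective fun p : S × C => d p.1 p.2)
    (q : C → ℕ) (hq : ∑ c, q c = Fintype.card S) :
    ∃ M : S → C,
      (∀ c : C, (Finset.univ.filter fun s => M s = c).card = q c) ∧
      ¬ ∃ (s : S) (c : C), M s ≠ c ∧ d s c < d s (M s) ∧
          ∃ s' : S, M s' = c ∧ d s c < d s' c := by
  classical
  obtain ⟨M, h1, h2⟩ := stmt5_aux d (Fintype.card S) Finset.univ q Finset.card_univ hq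
  refine ⟨M, h1, ?_⟩
  rintro ⟨s, c, -, h3, s', rfl, h4⟩
  exact h2 s (Finset.mem_univ s) s' (Finset.mem_univ s') h3 h4
end

section
/- For every symmetric preference system d : S → C → ℝ and every quota function q : C → ℕ with ∑_{c ∈ C} q(c) = |S|, the stable matching is unique: if M₁ and M₂ are both stable matchings, then M₁ = M₂. -/
theorem stmt6_aux {S C : Type*} [Fintype S] [DecidableEq C]
    (d : S → C → ℝ) (hd : Function.Injective fun p : S × C => d p.1 p.2)
    (M₁ M₂ : S → C)
    (hc : ∀ c : C, (Finset.univ.filter fun s => M₁ s = c).card =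
      (Finset.univ.filter fun s => M₂ s = c).card)
    (hstable₂ : ¬ ∃ (s : S) (c : C), M₂ s ≠ c ∧ d s c < d s (M₂ s) ∧
        ∃ s' : S, M₂ s' = c ∧ d s c < d s' c)
    (s : S) (hne : M₁ s ≠ M₂ s) (hlt : d s (M₁ s) < d s (M₂ s)) :
    ∃ s', M₁ s' ≠ M₂ s' ∧ d s' (M₂ s') < d s (M₁ s) := by
  have h1 : ∃ s', M₂ s' = M₁ s ∧ M₁ s' ≠ M₁ s := by
    by_contra hcon
    push Not at hcon
    have hsub : (Finset.univ.filter fun t => M₂ t = M₁ s) ⊆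
        (Finset.univ.filter fun t => M₁ t = M₁ s) := by
      intro t ht
      simp only [Finset.mem_filter, Finset.mem_univ, true_and] at ht ⊢
      exact hcon t ht
    have heq := Finset.eq_of_subset_of_card_le hsub (hc (M₁ s)).le
    have hs : s ∈ (Finset.univ.filter fun t => M₂ t = M₁ s) := by
      rw [heq]; simp
    simp only [Finset.mem_filter, Finset.mem_univ, true_and] at hs
    exact hne hs.symm
  obtain ⟨s', h2, h3⟩ := h1
  refine ⟨s', by rw [h2]; exact h3, ?_⟩
  rw [h2]
  rcases lt_trichotomy (d s' (M₁ s)) (d s (M₁ s)) with h | h | h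
  · exact h
  · have := @hd (s', M₁ s) (s, M₁ s) h
    have h4 : s' = s := congrArg Prod.fst this
    subst h4
    exact absurd rfl h3
  · exact absurd ⟨s, M₁ s, hne.symm, hlt, s', h2, h⟩ hstable₂

/-- For every symmetric preference system and quota function,
the stable matching is unique. -/
theorem stmt6 {S C : Type*} [Fintype S] [Fintype C] [Nonempty S] [Nonempty C]
    [DecidableEq C]
    (d : S → C → ℝ) (hd : Function.Injective fun p : S × C => d p.1 p.2)
    (q : C → ℕ) (hq : ∑ c, q c = Fintype.card S)
    (M₁ M₂ : S → C)
    (hM₁ : ∀ c : C, (Finset.univ.filter fun s => M₁ s = c).card = q c)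
    (hstable₁ : ¬ ∃ (s : S) (c : C), M₁ s ≠ c ∧ d s c < d s (M₁ s) ∧
        ∃ s' : S, M₁ s' = c ∧ d s c < d s' c)
    (hM₂ : ∀ c : C, (Finset.univ.filter fun s => M₂ s = c).card = q c)
    (hstable₂ : ¬ ∃ (s : S) (c : C), M₂ s ≠ c ∧ d s c < d s (M₂ s) ∧
        ∃ s' : S, M₂ s' = c ∧ d s c < d s' c) :
    M₁ = M₂ := by
  by_contra hne
  obtain ⟨s₀, hs₀⟩ := Function.ne_iff.mp hne
  obtain ⟨s, hs, hmin⟩ := Finset.exists_min_image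
    (Finset.univ.filter fun s => M₁ s ≠ M₂ s)
    (fun s => min (d s (M₁ s)) (d s (M₂ s))) ⟨s₀, by simpa using hs₀⟩
  simp only [Finset.mem_filter, Finset.mem_univ, true_and] at hs hmin
  rcases lt_trichotomy (d s (M₁ s)) (d s (M₂ s)) with h | h | h
  · obtain ⟨s', h1, h2⟩ := stmt6_aux d hd M₁ M₂ (fun c => (hM₁ c).trans (hM₂ c).symm)
      hstable₂ s hs h
    have h3 := hmin s' h1
    rw [min_eq_left h.le] at h3
    exact absurd (h3.trans (min_le_right _ _)) (not_le.mpr h2)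
  · exact hs (congrArg Prod.snd (@hd (s, M₁ s) (s, M₂ s) h))
  · obtain ⟨s', h1, h2⟩ := stmt6_aux d hd M₂ M₁ (fun c => (hM₂ c).trans (hM₁ c).symm)
      hstable₁ s hs.symm h
    have h3 := hmin s' h1.symm
    rw [min_eq_right h.le] at h3
    exact absurd (h3.trans (min_le_left _ _)) (not_le.mpr h2)
end

section
/- For every agent x in S ⊕ C, the nearest-neighbor chain starting at x reaches a mutual first-choice pair: there exists k ≥ 0 such that N(N(N^k(x))) = N^k(x), i.e., the agents N^k(x) and N^{k+1}(x) form a mutual first-choice pair. -/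
/-- Every nearest-neighbor chain reaches a mutual first-choice pair:
there exists k with N(N(N^[k](x))) = N^[k](x). -/
theorem stmt8 {S C : Type*} [Fintype S] [Fintype C] [Nonempty S] [Nonempty C]
    (d : S → C → ℝ) (hd : Function.Injective fun p : S × C => d p.1 p.2)
    (N : S ⊕ C → S ⊕ C)
    (hNs : ∀ s : S, ∃ c : C, N (Sum.inl s) = Sum.inr c ∧
        ∀ c' : C, c' ≠ c → d s c < d s c')
    (hNc : ∀ c : C, ∃ s : S, N (Sum.inr c) = Sum.inl s ∧
        ∀ s' : S, s' ≠ s → d s c < d s' c)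
    (x : S ⊕ C) :
    ∃ k : ℕ, N (N (N^[k] x)) = N^[k] x := by
  choose c hc hc' using hNs
  choose s hs hs' using hNc
  let f : S ⊕ C → ℝ := Sum.elim (fun a => d a (c a)) (fun b => d (s b) b)
  have key : ∀ a, N (N a) ≠ a → f (N a) < f a := by
    rintro (a | b) h
    · rw [hc, hs] at h
      rw [hc]
      exact hs' (c a) a (fun e => h (by rw [← e]))
    · rw [hs, hc] at h
      rw [hs]
      exact hc' (s b) b (fun e => h (by rw [← e]))
  by_contra hcon
  push Not at hcon
  have hanti : StrictAnti (fun k : ℕ => f (N^[k] x)) := by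
    refine strictAnti_nat_of_succ_lt fun k => ?_
    rw [Function.iterate_succ_apply']
    exact key _ (hcon k)
  have hinj : Function.Injective (fun k : ℕ => N^[k] x) := fun i j h =>
    hanti.injective (congrArg f h)
  exact not_injective_infinite_finite _ hinj
end

section
/- Symmetric preferences satisfy Eeckhout's uniqueness condition for one-to-one stable matching: if |S| = |C| = n and d : S → C → ℝ is a symmetric preference system, then there exist enumerations s₁, …, sₙ of S and c₁, …, cₙ of C such that for all indices i < j, d(sᵢ, cᵢ) < d(sᵢ, cⱼ) and d(sᵢ, cᵢ) < d(sⱼ, cᵢ). -/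
theorem stmt11_aux {S C : Type*} [DecidableEq S] [DecidableEq C]
    (d : S → C → ℝ) (hd : Function.Injective fun p : S × C => d p.1 p.2) (n : ℕ) :
    ∀ (A : Finset S) (B : Finset C), A.card = n → B.card = n →
    ∃ (e : Fin n → S) (f : Fin n → C), Function.Injective e ∧ Function.Injective f ∧
      (∀ i, e i ∈ A) ∧ (∀ i, f i ∈ B) ∧
      ∀ i j : Fin n, i < j →
        d (e i) (f i) < d (e i) (f j) ∧ d (e i) (f i) < d (e j) (f i) := by
  induction n with
  | zero =>
    intro A B _ _
    exact ⟨Fin.elim0, Fin.elim0, fun i => i.elim0, fun i => i.elim0, fun i => i.elim0,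
      fun i => i.elim0, fun i => i.elim0⟩
  | succ n ih =>
    intro A B hA hB
    have hAn : A.Nonempty := by rw [← Finset.card_pos]; omega
    have hBn : B.Nonempty := by rw [← Finset.card_pos]; omega
    obtain ⟨⟨a, b⟩, hab, hmin⟩ := Finset.exists_min_image (A ×ˢ B)
      (fun p : S × C => d p.1 p.2) (hAn.product hBn)
    rw [Finset.mem_product] at hab
    obtain ⟨ha, hb⟩ := hab
    simp only at ha hb
    obtain ⟨e, f, he, hf, heA, hfB, h⟩ := ih (A.erase a) (B.erase b)
      (by rw [Finset.card_erase_of_mem ha]; omega) (by rw [Finset.card_erase_of_mem hb]; omega)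
    have hlt : ∀ s ∈ A, ∀ c ∈ B, (s ≠ a ∨ c ≠ b) → d a b < d s c := by
      intro s hs c hc hne
      refine lt_of_le_of_ne (hmin (s, c) (Finset.mk_mem_product hs hc)) ?_
      intro heq
      have := @hd (a, b) (s, c) heq
      simp only [Prod.mk.injEq] at this
      rcases hne with h1 | h1
      · exact h1 this.1.symm
      · exact h1 this.2.symm
    refine ⟨Fin.cons a e, Fin.cons b f, ?_, ?_, ?_, ?_, ?_⟩
    · rw [Fin.cons_injective_iff]
      refine ⟨?_, he⟩
      rintro ⟨i, hi⟩
      exact (Finset.mem_erase.1 (heA i)).1 hi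
    · rw [Fin.cons_injective_iff]
      refine ⟨?_, hf⟩
      rintro ⟨i, hi⟩
      exact (Finset.mem_erase.1 (hfB i)).1 hi
    · intro i
      refine Fin.cases ?_ (fun i => ?_) i
      · simpa using ha
      · simpa using (Finset.mem_erase.1 (heA i)).2
    · intro i
      refine Fin.cases ?_ (fun i => ?_) i
      · simpa using hb
      · simpa using (Finset.mem_erase.1 (hfB i)).2
    · intro i j
      refine Fin.cases ?_ (fun j => ?_) j
      · intro hij
        exact absurd hij (Fin.not_lt_zero i)
      · refine Fin.cases ?_ (fun i => ?_) i
        · intro _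
          have h1 := Finset.mem_erase.1 (heA j)
          have h2 := Finset.mem_erase.1 (hfB j)
          simp only [Fin.cons_zero, Fin.cons_succ]
          exact ⟨hlt _ ha _ h2.2 (Or.inr h2.1), hlt _ h1.2 _ hb (Or.inl h1.1)⟩
        · intro hij
          simp only [Fin.cons_succ]
          exact h i j (Fin.succ_lt_succ_iff.1 hij)

/-- Symmetric preferences satisfy Eeckhout's uniqueness condition:
there are enumerations s₁, …, sₙ of S and c₁, …, cₙ of C such that for i < j,
d(sᵢ, cᵢ) < d(sᵢ, cⱼ) and d(sᵢ, cᵢ) < d(sⱼ, cᵢ). -/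
theorem stmt11 {S C : Type*} [Fintype S] [Fintype C] [Nonempty S] [Nonempty C] {n : ℕ}
    (hS : Fintype.card S = n) (hC : Fintype.card C = n)
    (d : S → C → ℝ) (hd : Function.Injective fun p : S × C => d p.1 p.2) :
    ∃ (e : Fin n ≃ S) (f : Fin n ≃ C),
      ∀ i j : Fin n, i < j →
        d (e i) (f i) < d (e i) (f j) ∧ d (e i) (f i) < d (e j) (f i) := by
  classical
  obtain ⟨e, f, he, hf, -, -, h⟩ := stmt11_aux d hd n Finset.univ Finset.univ
    (by simpa using hS) (by simpa using hC)
  exact ⟨Equiv.ofBijective e ((Fintype.bijective_iff_injective_and_card e).2 ⟨he, by simp [hS]⟩),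
    Equiv.ofBijective f ((Fintype.bijective_iff_injective_and_card f).2 ⟨hf, by simp [hC]⟩), h⟩
end
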